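/- In the agnostic mistake-known online multi-label setting, for any multi-label hypothesis class H with finite LD_K(H), finite label set Y, and T ≥ LD_K(H), there exists a learner A with regret R^known_A(T, H) = O(√(|Y| · T · LD_K(H) · log T)). -/

import Mathlib

/-- The prefix of length `t` of a root-to-leaf path `σ`. -/
def pref {Y : Type} {d : ℕ} (σ : Fin d → Y) (t : Fin d) : Fin t.1 → Y :=
  fun i => σ ⟨i.1, i.isLt.trans t.isLt⟩

/-- A complete multi-label tree of depth `d`: at each level `t`, each node
(reached by a path prefix) carries an instance, and each child (indexed by the
edge label `ŷ`) carries a label in `Y`. -/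
structure MTree (X Y : Type) (d : ℕ) where
  inst : ∀ t : Fin d, (Fin t.1 → Y) → X
  lab : ∀ t : Fin d, (Fin t.1 → Y) → Y → Y

/-- Consistency of a hypothesis with the labels along a path. -/
def ConsistentU {X Y : Type} (h : X → Set Y) {d : ℕ} (T : MTree X Y d) (σ : Fin d → Y) : Prop :=
  ∀ t : Fin d, T.lab t (pref σ t) (σ t) ∈ h (T.inst t (pref σ t))

open scoped Classical in
/-- Number of mistakes of path `σ` against hypothesis `h`. -/
noncomputable def mistakes {X Y : Type} (h : X → Set Y) {d : ℕ} (T : MTree X Y d)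
    (σ : Fin d → Y) : ℕ :=
  (Finset.univ.filter (fun t : Fin d => σ t ∉ h (T.inst t (pref σ t)))).card

/-- `T` is `d`-shattered by `(H, μ)` in the mistake-unknown sense. -/
def ShattersU {X Y : Type} (H : Set (X → Set Y)) (μ : (X → Set Y) → ℕ) {d' : ℕ}
    (T : MTree X Y d') (d : ℕ) : Prop :=
  ∀ σ : Fin d' → Y, ∃ h ∈ H, ConsistentU h T σ ∧ d ≤ mistakes h T σ + μ h

/-- Mistake-unknown multi-label Littlestone dimension with offset `μ`. -/
noncomputable def LDU {X Y : Type} (H : Set (X → Set Y)) (μ : (X → Set Y) → ℕ) : ℕ∞ :=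
  ⨆ (d : ℕ) (_ : ∃ d' : ℕ, ∃ T : MTree X Y d', ShattersU H μ T d), (d : ℕ∞)

/-- `T` is shattered by `H` in the mistake-known sense: a mistake at every step. -/
def ShattersK {X Y : Type} (H : Set (X → Set Y)) {d : ℕ} (T : MTree X Y d) : Prop :=
  ∀ σ : Fin d → Y, ∃ h ∈ H, ConsistentU h T σ ∧
    ∀ t : Fin d, σ t ∉ h (T.inst t (pref σ t))

/-- Mistake-known multi-label Littlestone dimension. -/
noncomputable def LDK {X Y : Type} (H : Set (X → Set Y)) : ℕ∞ :=
  ⨆ (d : ℕ) (_ : ∃ T : MTree X Y d, ShattersK H T), (d : ℕ∞)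

/-- A complete set-valued tree of depth `d`. -/
structure STree (X Y : Type) (d : ℕ) where
  inst : ∀ t : Fin d, (Fin t.1 → Y) → X
  lab : ∀ t : Fin d, (Fin t.1 → Y) → Y → Set Y

/-- `T` is shattered by `H` in the set-valued sense. -/
def ShattersS {X Y : Type} (H : Set (X → Set Y)) {d : ℕ} (T : STree X Y d) : Prop :=
  ∀ σ : Fin d → Y, ∃ h ∈ H,
    (∀ t : Fin d, T.lab t (pref σ t) (σ t) = h (T.inst t (pref σ t))) ∧
    ∀ t : Fin d, σ t ∉ h (T.inst t (pref σ t))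

/-- Set-valued Littlestone dimension. -/
noncomputable def LDS {X Y : Type} (H : Set (X → Set Y)) : ℕ∞ :=
  ⨆ (d : ℕ) (_ : ∃ T : STree X Y d, ShattersS H T), (d : ℕ∞)

open scoped Classical in
/-- The mistake bit of the prediction `a` against the correct set `S`. -/
noncomputable def mistakeBit {Y : Type} (S : Set Y) (a : Y) : Bool := if a ∈ S then false else true

open scoped Classical in
/-- The zero-one loss of the prediction `a` against the correct set `S`. -/
noncomputable def setLoss {Y : Type} (S : Set Y) (a : Y) : ℝ := if a ∉ S then 1 else 0

/-- Expected number of mistakes of a learner on a list of rounds, computed round by round. -/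
noncomputable def expectedMistakes {X Y : Type} [Fintype Y] :
    (List (X × Y × Bool) → X → PMF Y) → List (X × Y × Set Y) → ℝ
  | _, [] => 0
  | A, (x, y, S) :: r => ∑ a, (A [] x a).toReal *
      (setLoss S a + expectedMistakes (fun h => A ((x, y, mistakeBit S a) :: h)) r)

/-- The probability that the learner predicts `π` on the given rounds. -/
noncomputable def trajectoryProb {X Y : Type} {T : ℕ} (A : List (X × Y × Bool) → X → PMF Y)
    (x : Fin T → X) (y : Fin T → Y) (S : Fin T → Set Y) (π : Fin T → Y) : ℝ :=
  ∏ t : Fin T, ((A (List.ofFn fun i : Fin t.1 =>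
    (x ⟨i.1, i.isLt.trans t.isLt⟩, y ⟨i.1, i.isLt.trans t.isLt⟩,
      mistakeBit (S ⟨i.1, i.isLt.trans t.isLt⟩) (π ⟨i.1, i.isLt.trans t.isLt⟩))) (x t))
        (π t)).toReal

theorem PMF.sum_toReal_eq_one {Y : Type} [Fintype Y] (p : PMF Y) : ∑ a, (p a).toReal = 1 := by
  have h := p.tsum_coe
  rw [tsum_fintype] at h
  rw [← ENNReal.toReal_sum (fun a _ => p.apply_ne_top a), h, ENNReal.toReal_one]

theorem trajectoryProb_cons {X Y : Type} {T : ℕ} (A : List (X × Y × Bool) → X → PMF Y)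
    (x : Fin (T + 1) → X) (y : Fin (T + 1) → Y) (S : Fin (T + 1) → Set Y) (a : Y)
    (π : Fin T → Y) :
    trajectoryProb A x y S (Fin.cons a π) = (A [] (x 0) a).toReal *
      trajectoryProb (fun h => A ((x 0, y 0, mistakeBit (S 0) a) :: h))
        (fun t => x t.succ) (fun t => y t.succ) (fun t => S t.succ) π := by
  unfold trajectoryProb
  rw [Fin.prod_univ_succ]
  congr 1
  refine Finset.prod_congr rfl fun t _ => ?_
  rw [Fin.cons_succ]
  congr 3
  exact List.ofFn_succ

theorem sum_trajectory_cons {Y : Type} [Fintype Y] {T : ℕ} (f : (Fin (T + 1) → Y) → ℝ) :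
    ∑ π, f π = ∑ a, ∑ π : Fin T → Y, f (Fin.cons a π) := by
  rw [← Fintype.sum_prod_type']
  exact (Fintype.sum_equiv (Fin.consEquiv fun _ => Y) _ _ (fun _ => rfl)).symm

theorem sum_trajectoryProb {X Y : Type} [Fintype Y] {T : ℕ} (A : List (X × Y × Bool) → X → PMF Y)
    (x : Fin T → X) (y : Fin T → Y) (S : Fin T → Set Y) :
    ∑ π, trajectoryProb A x y S π = 1 := by
  induction T generalizing A with
  | zero => simp [trajectoryProb]
  | succ T ih =>
    rw [sum_trajectory_cons]
    simp_rw [trajectoryProb_cons, ← Finset.mul_sum, ih, mul_one]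
    exact PMF.sum_toReal_eq_one _

theorem sum_trajectoryProb_mul_loss {X Y : Type} [Fintype Y] {T : ℕ}
    (A : List (X × Y × Bool) → X → PMF Y)
    (x : Fin T → X) (y : Fin T → Y) (S : Fin T → Set Y) :
    ∑ π, trajectoryProb A x y S π * ∑ t, setLoss (S t) (π t) =
      expectedMistakes A (List.ofFn fun t => (x t, y t, S t)) := by
  induction T generalizing A with
  | zero => simp [expectedMistakes]
  | succ T ih =>
    rw [sum_trajectory_cons, List.ofFn_succ, expectedMistakes]
    refine Finset.sum_congr rfl fun a _ => ?_
    rw [← ih]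
    simp_rw [trajectoryProb_cons, Fin.sum_univ_succ, Fin.cons_zero, Fin.cons_succ, mul_assoc]
    rw [← Finset.mul_sum]
    simp_rw [mul_add]
    rw [Finset.sum_add_distrib, ← Finset.sum_mul, sum_trajectoryProb, one_mul]
    ring

/-- Expected number of mistakes of a learner that sees a context before each prediction and its own
mistake bit afterwards. -/
noncomputable def contextMistakes {C Y : Type} [Fintype Y] :
    (List (C × Bool) → C → PMF Y) → List (C × Set Y) → ℝ
  | _, [] => 0
  | P, (c, S) :: r => ∑ a, (P [] c a).toReal *
      (setLoss S a + contextMistakes (fun h => P ((c, mistakeBit S a) :: h)) r)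

/-- Expectation of `φ` of the number of mistakes of a learner with internal state that remembers its
own predictions. -/
noncomputable def recallExpect {W C Y : Type} [Fintype Y] (p : W → C → Y → ℝ)
    (upd : W → C → Y → Bool → W) : W → List (C × Set Y) → (ℝ → ℝ) → ℝ
  | _, [], φ => φ 0
  | w, (c, S) :: r, φ => ∑ a, p w c a *
      recallExpect p upd (upd w c a (mistakeBit S a)) r (fun L => φ (setLoss S a + L))

/-- Number of mistakes of expert `i` when the context lists the predictions of all experts. -/
noncomputable def expertMistakes {E Y : Type} (i : E) (r : List ((E → Y) × Set Y)) : ℝ :=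
  (r.map fun ρ => setLoss ρ.2 (ρ.1 i)).sum

theorem setLoss_nonneg {Y : Type} (S : Set Y) (a : Y) : 0 ≤ setLoss S a := by
  unfold setLoss; split_ifs <;> norm_num

theorem setLoss_le_one {Y : Type} (S : Set Y) (a : Y) : setLoss S a ≤ 1 := by
  unfold setLoss; split_ifs <;> norm_num

theorem expertMistakes_nonneg {E Y : Type} (i : E) (r : List ((E → Y) × Set Y)) :
    0 ≤ expertMistakes i r :=
  List.sum_nonneg (List.forall_mem_map.mpr fun _ _ => setLoss_nonneg _ _)

theorem expertMistakes_cons {E Y : Type} (i : E) (ρ : (E → Y) × Set Y)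
    (r : List ((E → Y) × Set Y)) :
    expertMistakes i (ρ :: r) = setLoss ρ.2 (ρ.1 i) + expertMistakes i r := by
  simp [expertMistakes]

theorem expertMistakes_le_length {E Y : Type} (i : E) (r : List ((E → Y) × Set Y)) :
    expertMistakes i r ≤ r.length := by
  induction r with
  | nil => simp [expertMistakes]
  | cons ρ r ih =>
    rw [expertMistakes_cons, List.length_cons]
    push_cast
    linarith [setLoss_le_one ρ.2 (ρ.1 i)]

theorem contextMistakes_of_pure {C Y : Type} [Fintype Y] (P : List (C × Bool) → C → PMF Y) (c : C)
    (S : Set Y) (r : List (C × Set Y)) (a : Y) (ha : P [] c = PMF.pure a) :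
    contextMistakes P ((c, S) :: r) =
      setLoss S a + contextMistakes (fun h => P ((c, mistakeBit S a) :: h)) r := by
  rw [contextMistakes, ha, Finset.sum_eq_single a]
  · simp
  · intro b _ hb; simp [PMF.pure_apply, hb]
  · simp

section Recall

variable {W C Y : Type} [Fintype Y] {p : W → C → Y → ℝ} {upd : W → C → Y → Bool → W}

theorem recallExpect_zero (w : W) (r : List (C × Set Y)) :
    recallExpect p upd w r (fun _ => 0) = 0 := by
  induction r generalizing w with
  | nil => rfl
  | cons ρ r ih => obtain ⟨c, S⟩ := ρ; simp [recallExpect, ih]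

theorem recallExpect_affine (hsum : ∀ w c, ∑ a, p w c a = 1) (w : W) (r : List (C × Set Y))
    (α β : ℝ) :
    recallExpect p upd w r (fun L => α + β * L) =
      α + β * recallExpect p upd w r (fun L => L) := by
  have key : ∀ (r : List (C × Set Y)) (w : W) (γ α β : ℝ),
      recallExpect p upd w r (fun L => α + β * (γ + L)) =
        α + β * (γ + recallExpect p upd w r (fun L => L)) := by
    intro r
    induction r with
    | nil => intro w γ α β; simp [recallExpect]
    | cons ρ r ih =>
      obtain ⟨c, S⟩ := ρ
      intro w γ α β
      have h1 : ∀ a, recallExpect p upd (upd w c a (mistakeBit S a)) r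
          (fun L => α + β * (γ + (setLoss S a + L))) = α + β * (γ + (setLoss S a +
            recallExpect p upd (upd w c a (mistakeBit S a)) r (fun L => L))) := by
        intro a
        simpa [add_assoc] using ih (upd w c a (mistakeBit S a)) (γ + setLoss S a) α β
      have h2 : ∀ a, recallExpect p upd (upd w c a (mistakeBit S a)) r
          (fun L => setLoss S a + L) = setLoss S a +
            recallExpect p upd (upd w c a (mistakeBit S a)) r (fun L => L) := by
        intro a
        simpa using ih (upd w c a (mistakeBit S a)) (setLoss S a) 0 1
      simp only [recallExpect, h1, h2]
      have h3 : ∀ a, p w c a * (α + β * (γ + (setLoss S a +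
            recallExpect p upd (upd w c a (mistakeBit S a)) r (fun L => L)))) =
          p w c a * (α + β * γ) + β * (p w c a * (setLoss S a +
            recallExpect p upd (upd w c a (mistakeBit S a)) r (fun L => L))) := by
        intro a; ring
      simp only [h3, Finset.sum_add_distrib, ← Finset.sum_mul, hsum, ← Finset.mul_sum]
      ring
  simpa using key r w 0 α β

theorem recallExpect_mono (hp : ∀ w c a, 0 ≤ p w c a) (w : W) (r : List (C × Set Y))
    (φ ψ : ℝ → ℝ) (h : ∀ L : ℝ, 0 ≤ L → L ≤ r.length → φ L ≤ ψ L) :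
    recallExpect p upd w r φ ≤ recallExpect p upd w r ψ := by
  induction r generalizing w φ ψ with
  | nil => exact h 0 le_rfl (by simp)
  | cons ρ r ih =>
    obtain ⟨c, S⟩ := ρ
    refine Finset.sum_le_sum fun a _ => mul_le_mul_of_nonneg_left (ih _ _ _ fun L h0 h1 => ?_)
      (hp _ _ _)
    refine h _ (add_nonneg (setLoss_nonneg _ _) h0) ?_
    rw [List.length_cons]
    push_cast
    linarith [setLoss_le_one S a]

theorem exists_le_weighted_sum {Y : Type} [Fintype Y] (p Q : Y → ℝ) (hp : ∀ a, 0 ≤ p a)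
    (hsum : ∑ a, p a = 1) : ∃ a, Q a ≤ ∑ a, p a * Q a := by
  by_contra! h
  have h1 : ∑ a, p a * (∑ b, p b * Q b) < ∑ a, p a * Q a := by
    refine Finset.sum_lt_sum (fun a _ => mul_le_mul_of_nonneg_left (h a).le (hp a)) ?_
    have : ∃ a, p a ≠ 0 := by
      by_contra! h0
      simp [h0] at hsum
    obtain ⟨a, ha⟩ := this
    exact ⟨a, Finset.mem_univ _, mul_lt_mul_of_pos_left (h a) (lt_of_le_of_ne (hp a) ha.symm)⟩
  rw [← Finset.sum_mul, hsum, one_mul] at h1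
  exact lt_irrefl _ h1

/-- A deterministic learner without recall does at least as well as a randomized one with recall on
any fixed finite mixture of round sequences. -/
theorem exists_deterministic_le_recallExpect [Fintype C] {J : Type} [Fintype J]
    (hp : ∀ w c a, 0 ≤ p w c a) (hsum : ∀ w c, ∑ a, p w c a = 1) (n : ℕ) (w : W)
    (r : J → List (C × Set Y)) (hr : ∀ j, (r j).length = n) (φ : J → ℝ → ℝ) :
    ∃ P : List (C × Bool) → C → PMF Y,
      ∑ j, φ j (contextMistakes P (r j)) ≤ ∑ j, recallExpect p upd w (r j) (φ j) := by
  classical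
  induction n generalizing w r φ with
  | zero =>
    have hnil : ∀ j, r j = [] := fun j => List.length_eq_zero_iff.mp (hr j)
    have hY : ∀ c : C, Nonempty Y := by
      intro c
      by_contra hY
      rw [not_nonempty_iff] at hY
      simpa using hsum w c
    refine ⟨fun _ c => PMF.pure (hY c).some, ?_⟩
    simp [hnil, contextMistakes, recallExpect]
  | succ n ih =>
    have hcons : ∀ j, ∃ c S l, r j = (c, S) :: l ∧ l.length = n := by
      intro j
      obtain ⟨ρ, l, hl⟩ := List.exists_cons_of_length_eq_add_one (hr j)
      refine ⟨ρ.1, ρ.2, l, hl, ?_⟩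
      have := hr j
      rw [hl] at this
      simpa using this
    choose c S l hrl hl using hcons
    let Q : C → Y → ℝ := fun c₀ a => ∑ j, if c j = c₀ then
      recallExpect p upd (upd w (c j) a (mistakeBit (S j) a)) (l j)
        (fun L => φ j (setLoss (S j) a + L)) else 0
    choose act hact using fun c₀ => exists_le_weighted_sum (p w c₀) (Q c₀) (hp w c₀) (hsum w c₀)
    choose sub hsub using fun (c₀ : C) (b : Bool) => ih (upd w c₀ (act c₀) b) l hl
      (fun j => if c j = c₀ ∧ mistakeBit (S j) (act c₀) = b then
        (fun L => φ j (setLoss (S j) (act c₀) + L)) else fun _ => 0)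
    let P : List (C × Bool) → C → PMF Y := fun h c₀ => match h with
      | [] => PMF.pure (act c₀)
      | (c₁, b) :: h => sub c₁ b h c₀
    refine ⟨P, ?_⟩
    calc ∑ j, φ j (contextMistakes P (r j))
        = ∑ j, φ j (setLoss (S j) (act (c j)) +
            contextMistakes (sub (c j) (mistakeBit (S j) (act (c j)))) (l j)) := by
          refine Finset.sum_congr rfl fun j _ => ?_
          rw [hrl, contextMistakes_of_pure P (c j) (S j) (l j) (act (c j)) rfl]
      _ = ∑ c₀, ∑ b, ∑ j, (if c j = c₀ ∧ mistakeBit (S j) (act c₀) = b then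
            (fun L => φ j (setLoss (S j) (act c₀) + L)) else fun _ => 0)
              (contextMistakes (sub c₀ b) (l j)) := by
          rw [Finset.sum_congr rfl fun c₀ _ => Finset.sum_comm, Finset.sum_comm]
          refine Finset.sum_congr rfl fun j _ => ?_
          rw [Finset.sum_eq_single (c j), Finset.sum_eq_single (mistakeBit (S j) (act (c j)))]
          · simp
          · intro b _ hb; simp [hb.symm]
          · simp
          · intro c₀ _ hc; simp [hc.symm]
          · simp
      _ ≤ ∑ c₀, ∑ b, ∑ j, recallExpect p upd (upd w c₀ (act c₀) b) (l j)
            (if c j = c₀ ∧ mistakeBit (S j) (act c₀) = b then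
              (fun L => φ j (setLoss (S j) (act c₀) + L)) else fun _ => 0) :=
          Finset.sum_le_sum fun c₀ _ => Finset.sum_le_sum fun b _ => hsub c₀ b
      _ = ∑ c₀, Q c₀ (act c₀) := by
          refine Finset.sum_congr rfl fun c₀ _ => ?_
          rw [Finset.sum_comm]
          refine Finset.sum_congr rfl fun j _ => ?_
          rw [Finset.sum_eq_single (mistakeBit (S j) (act c₀))]
          · by_cases hc : c j = c₀
            · subst hc; simp
            · simp [hc, recallExpect_zero]
          · intro b _ hb; simp [hb.symm, recallExpect_zero]
          · simp
      _ ≤ ∑ c₀, ∑ a, p w c₀ a * Q c₀ a := Finset.sum_le_sum fun c₀ _ => hact c₀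
      _ = ∑ j, recallExpect p upd w (r j) (φ j) := by
          simp_rw [Q, Finset.mul_sum]
          rw [Finset.sum_congr rfl fun c₀ _ => Finset.sum_comm, Finset.sum_comm]
          refine Finset.sum_congr rfl fun j _ => ?_
          rw [Finset.sum_eq_single (c j)]
          · simp [hrl, recallExpect]
          · intro c₀ _ hc; simp [hc.symm]
          · simp

end Recall

section ExponentialWeights

variable {E Y : Type} [Fintype E]

open scoped Classical in
/-- The prediction distribution of exponential weights with expert weights `w` and expert
predictions `c`. -/
noncomputable def expertProb (w : {w : E → ℝ // ∀ i, 0 < w i}) (c : E → Y) (a : Y) : ℝ :=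
  (∑ i, if c i = a then w.1 i else 0) / ∑ i, w.1 i

open scoped Classical in
/-- The importance-weighted update of the expert weights. -/
noncomputable def expertUpdate (η : ℝ) (w : {w : E → ℝ // ∀ i, 0 < w i}) (c : E → Y) (a : Y)
    (b : Bool) : {w : E → ℝ // ∀ i, 0 < w i} :=
  ⟨fun i => if b = true ∧ c i = a then w.1 i * Real.exp (-(η / expertProb w c a)) else w.1 i,
    fun i => by
      have := w.2 i
      beta_reduce
      split_ifs <;> positivity⟩

theorem expertProb_nonneg (w : {w : E → ℝ // ∀ i, 0 < w i}) (c : E → Y) (a : Y) :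
    0 ≤ expertProb w c a := by
  refine div_nonneg (Finset.sum_nonneg fun i _ => ?_) (Finset.sum_nonneg fun i _ => (w.2 i).le)
  split_ifs
  exacts [(w.2 i).le, le_rfl]

variable [Nonempty E]

theorem sum_weights_pos (w : {w : E → ℝ // ∀ i, 0 < w i}) : 0 < ∑ i, w.1 i :=
  Finset.sum_pos (fun i _ => w.2 i) Finset.univ_nonempty

theorem exp_neg_le_quadratic {x : ℝ} (hx : 0 ≤ x) : Real.exp (-x) ≤ 1 - x + x ^ 2 / 2 := by
  have h1 := Real.quadratic_le_exp_of_nonneg hx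
  have h2 : 0 < 1 + x + x ^ 2 / 2 := by positivity
  rw [Real.exp_neg]
  calc (Real.exp x)⁻¹ ≤ (1 + x + x ^ 2 / 2)⁻¹ := inv_anti₀ h2 h1
    _ ≤ 1 - x + x ^ 2 / 2 := by
      rw [inv_le_iff_one_le_mul₀ h2]
      nlinarith [sq_nonneg (x ^ 2)]

theorem expertUpdate_step (η : ℝ) (hη : 0 < η) (w : {w : E → ℝ // ∀ i, 0 < w i}) (c : E → Y)
    (S : Set Y) (a : Y) (i : E) [Decidable (c i = a)] :
    expertProb w c a * (setLoss S a + 1 / η *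
        (Real.log (∑ j, (expertUpdate η w c a (mistakeBit S a)).1 j) -
          Real.log ((expertUpdate η w c a (mistakeBit S a)).1 i))) ≤
      expertProb w c a * (1 / η * (Real.log (∑ j, w.1 j) - Real.log (w.1 i))) +
        (if c i = a then setLoss S a else 0) + η / 2 := by
  have hp := expertProb_nonneg w c a
  by_cases haS : a ∈ S
  · have hb : mistakeBit S a = false := by simp [mistakeBit, haS]
    have hl : setLoss S a = 0 := by simp [setLoss, haS]
    have hu : expertUpdate η w c a false = w := by
      apply Subtype.ext; simp [expertUpdate]
    rw [hb, hl, hu, ite_self]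
    simp only [zero_add, add_zero]
    linarith
  · have hb : mistakeBit S a = true := by simp [mistakeBit, haS]
    have hl : setLoss S a = 1 := by simp [setLoss, haS]
    rw [hb, hl]
    rcases hp.eq_or_lt with h0 | hpos
    · rw [← h0]
      split_ifs <;> simp <;> linarith
    · set q := expertProb w c a with hq
      have hW := sum_weights_pos w
      have hsum : ∑ j, (expertUpdate η w c a true).1 j =
          (∑ j, w.1 j) * (1 - q + q * Real.exp (-(η / q))) := by
        classical
        have h1 : ∀ j, (expertUpdate η w c a true).1 j =
            w.1 j - (if c j = a then w.1 j else 0) * (1 - Real.exp (-(η / q))) := by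
          intro j
          simp only [expertUpdate, true_and, ← hq]
          split_ifs <;> ring
        have h2 : (∑ j, if c j = a then w.1 j else 0) = (∑ j, w.1 j) * q := by
          rw [hq, expertProb]; field_simp
        simp only [h1, Finset.sum_sub_distrib, ← Finset.sum_mul, h2]
        ring
      have hfac : 1 - q + q * Real.exp (-(η / q)) ≤ Real.exp (-η + η ^ 2 / (2 * q)) := by
        have h3 := exp_neg_le_quadratic (x := η / q) (by positivity)
        have h4 : q * (1 - η / q + (η / q) ^ 2 / 2) = q - η + η ^ 2 / (2 * q) := by
          field_simp
        nlinarith [Real.add_one_le_exp (-η + η ^ 2 / (2 * q)),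
          mul_le_mul_of_nonneg_left h3 hpos.le]
      have hlogW : Real.log (∑ j, (expertUpdate η w c a true).1 j) ≤
          Real.log (∑ j, w.1 j) + (-η + η ^ 2 / (2 * q)) := by
        rw [← Real.log_exp (-η + η ^ 2 / (2 * q)), ← Real.log_mul hW.ne' (Real.exp_ne_zero _)]
        apply Real.log_le_log (sum_weights_pos _)
        rw [hsum]
        exact mul_le_mul_of_nonneg_left hfac hW.le
      have hlogw : Real.log ((expertUpdate η w c a true).1 i) =
          Real.log (w.1 i) - if c i = a then η / q else 0 := by
        by_cases hc : c i = a
        · simp only [expertUpdate, hc, and_self, if_true]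
          rw [Real.log_mul (w.2 i).ne' (Real.exp_ne_zero _), Real.log_exp, ← hq]
          ring
        · simp [expertUpdate, hc]
      rw [hlogw]
      calc q * (1 + 1 / η * (Real.log (∑ j, (expertUpdate η w c a true).1 j) -
              (Real.log (w.1 i) - if c i = a then η / q else 0)))
          ≤ q * (1 + 1 / η * (Real.log (∑ j, w.1 j) + (-η + η ^ 2 / (2 * q)) -
              (Real.log (w.1 i) - if c i = a then η / q else 0))) := by gcongr
        _ = _ := by split_ifs <;> field_simp <;> ring

variable [Fintype Y]

theorem sum_expertProb (w : {w : E → ℝ // ∀ i, 0 < w i}) (c : E → Y) :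
    ∑ a, expertProb w c a = 1 := by
  unfold expertProb
  rw [← Finset.sum_div, Finset.sum_comm]
  rw [Finset.sum_congr rfl fun i _ => Finset.sum_eq_single (c i)
    (fun a _ ha => if_neg ha.symm) (by simp)]
  simpa using div_self (sum_weights_pos w).ne'

theorem recallExpect_exponentialWeights_le (η : ℝ) (hη : 0 < η)
    (r : List ((E → Y) × Set Y)) (w : {w : E → ℝ // ∀ i, 0 < w i}) (i : E) :
    recallExpect expertProb (expertUpdate η) w r (fun L => L) ≤ expertMistakes i r +
      1 / η * (Real.log (∑ j, w.1 j) - Real.log (w.1 i)) +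
        η * Fintype.card Y / 2 * r.length := by
  classical
  induction r generalizing w with
  | nil =>
    have : Real.log (w.1 i) ≤ Real.log (∑ j, w.1 j) :=
      Real.log_le_log (w.2 i) (Finset.single_le_sum (fun j _ => (w.2 j).le) (Finset.mem_univ i))
    have h2 : 0 ≤ 1 / η * (Real.log (∑ j, w.1 j) - Real.log (w.1 i)) :=
      mul_nonneg (by positivity) (by linarith)
    simpa [recallExpect, expertMistakes] using h2
  | cons ρ r ih =>
    obtain ⟨c, S⟩ := ρ
    have haff : ∀ a, recallExpect expertProb (expertUpdate η)
        (expertUpdate η w c a (mistakeBit S a)) r (fun L => setLoss S a + L) = setLoss S a +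
          recallExpect expertProb (expertUpdate η)
            (expertUpdate η w c a (mistakeBit S a)) r (fun L => L) := by
      intro a
      simpa using recallExpect_affine (upd := expertUpdate η) sum_expertProb
        (expertUpdate η w c a (mistakeBit S a)) r (setLoss S a) 1
    simp only [recallExpect, haff]
    calc ∑ a, expertProb w c a * (setLoss S a + recallExpect expertProb (expertUpdate η)
            (expertUpdate η w c a (mistakeBit S a)) r (fun L => L))
        ≤ ∑ a, (expertProb w c a * (expertMistakes i r + η * Fintype.card Y / 2 * r.length +
            1 / η * (Real.log (∑ j, w.1 j) - Real.log (w.1 i))) +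
            (if c i = a then setLoss S a else 0) + η / 2) := by
          refine Finset.sum_le_sum fun a _ => ?_
          have h1 := expertUpdate_step η hη w c S a i
          have h2 := mul_le_mul_of_nonneg_left (ih (expertUpdate η w c a (mistakeBit S a)))
            (expertProb_nonneg w c a)
          nlinarith
      _ = _ := by
          rw [Finset.sum_add_distrib, Finset.sum_add_distrib, ← Finset.sum_mul, sum_expertProb,
            expertMistakes_cons]
          simp
          ring

/-- On any finite weighted family of round sequences, some deterministic learner has small
exponential moment of its scaled regret. -/
theorem exists_deterministic_exp_regret_le {J : Type} [Fintype J] (e : J → E) (T : ℕ)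
    (η lam δ M : ℝ) (hη : 0 < η) (hlam : 0 ≤ lam) (hδ : lam * δ * T ≤ 1)
    (hM : 1 / η * Real.log (Fintype.card E) + η * Fintype.card Y / 2 * T ≤ M)
    (n : ℕ) (hn : n ≤ T) (g P : J → ℝ) (hg : ∀ j, 0 ≤ g j) (hP : ∀ j, 0 ≤ P j)
    (hPδ : ∀ j, P j ≤ δ) (r : J → List ((E → Y) × Set Y)) (hr : ∀ j, (r j).length = n) :
    ∃ A : List ((E → Y) × Bool) → (E → Y) → PMF Y,
      ∑ j, g j * Real.exp (lam * (P j * (contextMistakes A (r j) - expertMistakes (e j) (r j)))) ≤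
        ∑ j, g j * Real.exp (P j * (lam * M + lam ^ 2 * T ^ 2 * δ)) := by
  classical
  let w₀ : {w : E → ℝ // ∀ i, 0 < w i} := ⟨fun _ => 1, fun _ => one_pos⟩
  obtain ⟨A, hA⟩ := exists_deterministic_le_recallExpect (C := E → Y)
    (upd := expertUpdate (E := E) (Y := Y) η) expertProb_nonneg
    sum_expertProb n w₀ r hr
    (fun j L => g j * Real.exp (lam * (P j * (L - expertMistakes (e j) (r j)))))
  refine ⟨A, hA.trans (Finset.sum_le_sum fun j _ => ?_)⟩
  set m := expertMistakes (e j) (r j) with hm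
  have hnT : (n : ℝ) ≤ T := by exact_mod_cast hn
  have hm0 : 0 ≤ m := expertMistakes_nonneg _ _
  have hmT : m ≤ T := by
    have := expertMistakes_le_length (e j) (r j)
    rw [hr j] at this
    linarith
  have hx : 0 ≤ lam * P j := mul_nonneg hlam (hP j)
  have hxT : lam * P j * T ≤ 1 := by
    refine le_trans ?_ hδ
    have := hPδ j
    gcongr
  have hreg : recallExpect expertProb (expertUpdate η) w₀ (r j) (fun L => L) ≤ m + M := by
    have h := recallExpect_exponentialWeights_le η hη (r j) w₀ (e j)
    rw [hr j] at h
    have h1 : ∑ j : E, w₀.1 j = Fintype.card E := by simp [w₀]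
    have h2 : w₀.1 (e j) = 1 := rfl
    rw [h1, h2, Real.log_one, sub_zero] at h
    have h3 : η * Fintype.card Y / 2 * n ≤ η * Fintype.card Y / 2 * T := by gcongr
    linarith
  have hstep : recallExpect expertProb (expertUpdate η) w₀ (r j)
      (fun L => g j * Real.exp (lam * (P j * (L - m)))) ≤
      recallExpect expertProb (expertUpdate η) w₀ (r j)
        (fun L => g j * (1 - lam * P j * m + lam ^ 2 * P j * δ * T ^ 2) +
          g j * (lam * P j) * L) := by
    refine recallExpect_mono expertProb_nonneg _ _ _ _ fun L h0 h1 => ?_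
    rw [hr j] at h1
    have habs : |L - m| ≤ T := abs_le.mpr ⟨by linarith, by linarith⟩
    have hz : |lam * P j * (L - m)| ≤ 1 := by
      rw [abs_mul, abs_of_nonneg hx]
      exact (mul_le_mul_of_nonneg_left habs hx).trans hxT
    have h2 := (abs_le.mp (Real.abs_exp_sub_one_sub_id_le hz)).2
    have hsq : (L - m) ^ 2 ≤ (T : ℝ) ^ 2 := sq_le_sq' (abs_le.mp habs).1 (abs_le.mp habs).2
    have h3 : (lam * P j * (L - m)) ^ 2 ≤ lam ^ 2 * P j * δ * T ^ 2 := by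
      calc (lam * P j * (L - m)) ^ 2 = lam ^ 2 * P j * P j * (L - m) ^ 2 := by ring
        _ ≤ lam ^ 2 * P j * δ * T ^ 2 := by
          have := hP j
          have := hPδ j
          have : 0 ≤ δ := by linarith
          gcongr
    rw [← mul_assoc lam, mul_assoc (g j) (lam * P j), ← mul_add]
    refine mul_le_mul_of_nonneg_left ?_ (hg j)
    linarith
  refine hstep.trans ?_
  rw [recallExpect_affine (upd := expertUpdate η) sum_expertProb, mul_assoc (g j), ← mul_add]
  refine mul_le_mul_of_nonneg_left ?_ (hg j)
  have h4 := mul_le_mul_of_nonneg_left hreg hx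
  have h5 := Real.add_one_le_exp (P j * (lam * M + lam ^ 2 * T ^ 2 * δ))
  nlinarith

end ExponentialWeights

/-- The probability that a uniform prediction is a mistake. -/
noncomputable def missRate {Y : Type} [Fintype Y] (S : Set Y) : ℝ :=
  (∑ a, setLoss S a) / Fintype.card Y

theorem missRate_nonneg {Y : Type} [Fintype Y] (S : Set Y) : 0 ≤ missRate S :=
  div_nonneg (Finset.sum_nonneg fun _ _ => setLoss_nonneg _ _) (Nat.cast_nonneg _)

theorem missRate_le {Y : Type} [Fintype Y] {S : Set Y} (hS : S.Nonempty) :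
    missRate S ≤ 1 - 1 / Fintype.card Y := by
  classical
  obtain ⟨y, hy⟩ := hS
  have hK : (0 : ℝ) < Fintype.card Y := by exact_mod_cast Fintype.card_pos_iff.mpr ⟨y⟩
  have h1 : ∑ a, setLoss S a ≤ ∑ a, (1 - if a = y then (1 : ℝ) else 0) := by
    refine Finset.sum_le_sum fun a _ => ?_
    split_ifs with h
    · simp [h, setLoss, hy]
    · simpa using setLoss_le_one S a
  rw [Finset.sum_sub_distrib] at h1
  simp only [Finset.sum_const, Finset.card_univ, nsmul_eq_mul, mul_one, Finset.sum_ite_eq',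
    Finset.mem_univ, if_true] at h1
  rw [missRate, div_le_iff₀ hK]
  have : (1 - 1 / (Fintype.card Y : ℝ)) * Fintype.card Y = Fintype.card Y - 1 := by
    field_simp
  linarith

theorem contextMistakes_of_uniform {C Y : Type} [Fintype Y] [Nonempty Y]
    (P : List (C × Bool) → C → PMF Y) (c : C) (S : Set Y) (r : List (C × Set Y))
    (hP : P [] c = PMF.uniformOfFintype Y) :
    contextMistakes P ((c, S) :: r) =
      missRate S * (1 + contextMistakes (fun h => P ((c, true) :: h)) r) +
        (1 - missRate S) * contextMistakes (fun h => P ((c, false) :: h)) r := by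
  have hK : (Fintype.card Y : ℝ) ≠ 0 := by exact_mod_cast Fintype.card_ne_zero
  have h1 : ∀ a, (P [] c a).toReal * (setLoss S a +
      contextMistakes (fun h => P ((c, mistakeBit S a) :: h)) r) = (Fintype.card Y : ℝ)⁻¹ *
        (setLoss S a * (1 + contextMistakes (fun h => P ((c, true) :: h)) r -
          contextMistakes (fun h => P ((c, false) :: h)) r) +
            contextMistakes (fun h => P ((c, false) :: h)) r) := by
    intro a
    have h2 : (P [] c a).toReal = (Fintype.card Y : ℝ)⁻¹ := by
      simp [hP, PMF.uniformOfFintype_apply]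
    rw [h2]
    by_cases ha : a ∈ S
    · simp [setLoss, mistakeBit, ha]
    · simp [setLoss, mistakeBit, ha]
  rw [contextMistakes, Finset.sum_congr rfl fun a _ => h1 a, ← Finset.mul_sum,
    Finset.sum_add_distrib, ← Finset.sum_mul, Finset.sum_const, Finset.card_univ, nsmul_eq_mul,
    missRate]
  field_simp
  ring

section Explore

variable {E Y : Type} [Fintype E] [Nonempty E] [Fintype Y] [Nonempty Y]

/-- Predicting uniformly until `k` mistakes have been observed makes every later history unlikely,
so that the exponential moment of the regret beyond those `k` mistakes stays small. -/
theorem exists_explore_exp_regret_le {J : Type} [Fintype J] (e : J → E) (T : ℕ)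
    (η lam δ M : ℝ) (hη : 0 < η) (hlam : 0 ≤ lam) (hδ₀ : 0 ≤ δ) (hδ : lam * δ * T ≤ 1)
    (hM : 1 / η * Real.log (Fintype.card E) + η * Fintype.card Y / 2 * T ≤ M) (hM₀ : 0 ≤ M)
    (n : ℕ) (hn : n ≤ T) (k : ℕ) (g P : J → ℝ) (hg : ∀ j, 0 ≤ g j) (hP : ∀ j, 0 ≤ P j)
    (hPδ : ∀ j, P j * (1 - 1 / (Fintype.card Y : ℝ)) ^ k ≤ δ) (r : J → List ((E → Y) × Set Y))
    (hr : ∀ j, (r j).length = n) (hS : ∀ j, ∀ ρ ∈ r j, ρ.2.Nonempty) :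
    ∃ A : List ((E → Y) × Bool) → (E → Y) → PMF Y,
      ∑ j, g j * Real.exp (lam * (P j *
          (contextMistakes A (r j) - expertMistakes (e j) (r j) - k))) ≤
        ∑ j, g j * Real.exp (P j * (lam * M + lam ^ 2 * T ^ 2 * δ)) := by
  have hκ : 0 ≤ lam * M + lam ^ 2 * T ^ 2 * δ := by positivity
  induction n generalizing k g P r with
  | zero =>
    have hnil : ∀ j, r j = [] := fun j => List.length_eq_zero_iff.mp (hr j)
    refine ⟨fun _ _ => PMF.uniformOfFintype Y, Finset.sum_le_sum fun j _ => ?_⟩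
    refine mul_le_mul_of_nonneg_left (Real.exp_le_exp.mpr ?_) (hg j)
    have h1 : 0 ≤ P j * (lam * M + lam ^ 2 * T ^ 2 * δ) := mul_nonneg (hP j) hκ
    have h2 : 0 ≤ lam * (P j * k) := mul_nonneg hlam (mul_nonneg (hP j) (Nat.cast_nonneg k))
    rw [hnil j]
    simp only [contextMistakes, expertMistakes, List.map_nil, List.sum_nil]
    linarith
  | succ n ih =>
    rcases k with _ | k
    · obtain ⟨A, hA⟩ := exists_deterministic_exp_regret_le e T η lam δ M hη hlam hδ hM (n + 1) hn
        g P hg hP (fun j => by simpa using hPδ j) r hr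
      exact ⟨A, by simpa using hA⟩
    have hcons : ∀ j, ∃ c S l, r j = (c, S) :: l ∧ l.length = n := by
      intro j
      obtain ⟨ρ, l, hl⟩ := List.exists_cons_of_length_eq_add_one (hr j)
      refine ⟨ρ.1, ρ.2, l, hl, ?_⟩
      have := hr j
      rw [hl] at this
      simpa using this
    choose c S l hrl hl using hcons
    have hSj : ∀ j, (S j).Nonempty := fun j => hS j (c j, S j) (by simp [hrl])
    have hSl : ∀ j, ∀ ρ ∈ l j, ρ.2.Nonempty := fun j ρ hρ => hS j ρ (by simp [hrl, hρ])
    have hs0 : ∀ j, 0 ≤ missRate (S j) := fun j => missRate_nonneg _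
    have hsq : ∀ j, missRate (S j) ≤ 1 - 1 / (Fintype.card Y : ℝ) := fun j => missRate_le (hSj j)
    have hq : (0 : ℝ) ≤ 1 - 1 / (Fintype.card Y : ℝ) := by
      have : (1 : ℝ) ≤ Fintype.card Y := by exact_mod_cast Fintype.card_pos
      rw [sub_nonneg, div_le_one (by linarith)]
      exact this
    have hs1 : ∀ j, 0 ≤ 1 - missRate (S j) := by
      intro j
      have : (0 : ℝ) ≤ 1 / (Fintype.card Y : ℝ) := by positivity
      linarith [hsq j]
    set κ := lam * M + lam ^ 2 * T ^ 2 * δ with hκdef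
    obtain ⟨At, hAt⟩ := ih (by omega) k
      (fun j => g j * Real.exp (P j * (1 - missRate (S j)) * κ)) (fun j => P j * missRate (S j))
      (fun j => mul_nonneg (hg j) (Real.exp_pos _).le) (fun j => mul_nonneg (hP j) (hs0 j))
      (fun j => by
        refine le_trans ?_ (hPδ j)
        rw [pow_succ', ← mul_assoc]
        exact mul_le_mul_of_nonneg_right (mul_le_mul_of_nonneg_left (hsq j) (hP j))
          (pow_nonneg hq k)) l hl hSl
    set Yt : J → ℝ := fun j => contextMistakes At (l j) - expertMistakes (e j) (l j) - k with hYt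
    obtain ⟨Af, hAf⟩ := ih (by omega) (k + 1)
      (fun j => g j * Real.exp (lam * (P j * missRate (S j) * Yt j)))
      (fun j => P j * (1 - missRate (S j)))
      (fun j => mul_nonneg (hg j) (Real.exp_pos _).le) (fun j => mul_nonneg (hP j) (hs1 j))
      (fun j => by
        refine le_trans (mul_le_mul_of_nonneg_right ?_ (pow_nonneg hq _)) (hPδ j)
        exact mul_le_of_le_one_right (hP j) (by linarith [hs0 j])) l hl hSl
    set Yf : J → ℝ := fun j =>
      contextMistakes Af (l j) - expertMistakes (e j) (l j) - ((k + 1 : ℕ) : ℝ) with hYf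
    let A : List ((E → Y) × Bool) → (E → Y) → PMF Y := fun h c₀ => match h with
      | [] => PMF.uniformOfFintype Y
      | (_, true) :: h => At h c₀
      | (_, false) :: h => Af h c₀
    refine ⟨A, ?_⟩
    calc ∑ j, g j * Real.exp (lam * (P j *
          (contextMistakes A (r j) - expertMistakes (e j) (r j) - ((k + 1 : ℕ) : ℝ))))
        ≤ ∑ j, g j * Real.exp (lam * (P j * missRate (S j) * Yt j)) *
            Real.exp (lam * (P j * (1 - missRate (S j)) * Yf j)) := by
          refine Finset.sum_le_sum fun j _ => ?_
          rw [mul_assoc (g j), ← Real.exp_add]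
          refine mul_le_mul_of_nonneg_left (Real.exp_le_exp.mpr ?_) (hg j)
          rw [← mul_add]
          refine mul_le_mul_of_nonneg_left ?_ hlam
          rw [mul_assoc (P j), mul_assoc (P j), ← mul_add]
          refine mul_le_mul_of_nonneg_left ?_ (hP j)
          rw [hrl, contextMistakes_of_uniform A _ _ _ rfl, expertMistakes_cons]
          have h0 := setLoss_nonneg (S j) (c j (e j))
          simp only [hYt, hYf, A]
          push_cast
          nlinarith
      _ ≤ ∑ j, g j * Real.exp (lam * (P j * missRate (S j) * Yt j)) *
            Real.exp (P j * (1 - missRate (S j)) * κ) := hAf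
      _ = ∑ j, g j * Real.exp (P j * (1 - missRate (S j)) * κ) *
            Real.exp (lam * (P j * missRate (S j) * Yt j)) :=
          Finset.sum_congr rfl fun j _ => mul_right_comm _ _ _
      _ ≤ ∑ j, g j * Real.exp (P j * (1 - missRate (S j)) * κ) *
            Real.exp (P j * missRate (S j) * κ) := hAt
      _ = ∑ j, g j * Real.exp (P j * κ) := by
          refine Finset.sum_congr rfl fun j _ => ?_
          rw [mul_assoc, ← Real.exp_add]
          ring_nf

/-- In the game whose contexts list all expert predictions, some learner has small regret against
every expert. -/
theorem exists_context_learner (T B : ℕ) (η lam δ M : ℝ) (hη : 0 < η) (hlam : 0 < lam)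
    (hδ : lam * δ * T ≤ 1) (hBδ : (1 - 1 / (Fintype.card Y : ℝ)) ^ B ≤ δ)
    (hM : 1 / η * Real.log (Fintype.card E) + η * Fintype.card Y / 2 * T ≤ M)
    (hcard : T * (Fintype.card E * Real.log (Fintype.card Y) + Fintype.card Y * Real.log 2) +
      Real.log (Fintype.card E) ≤ lam) :
    ∃ A : List ((E → Y) × Bool) → (E → Y) → PMF Y,
      ∀ r : List ((E → Y) × Set Y), r.length = T → (∀ ρ ∈ r, ρ.2.Nonempty) → ∀ i : E,
        contextMistakes A r ≤ expertMistakes i r + B + M + 1 + lam * T ^ 2 * δ := by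
  classical
  let J := {f : Fin T → (E → Y) × Set Y // ∀ t, (f t).2.Nonempty} × E
  have hK1 : (1 : ℝ) ≤ Fintype.card Y := by exact_mod_cast Fintype.card_pos
  have hE1 : (1 : ℝ) ≤ Fintype.card E := by exact_mod_cast Fintype.card_pos
  have hq : (0 : ℝ) ≤ 1 - 1 / (Fintype.card Y : ℝ) := by
    rw [sub_nonneg, div_le_one (by linarith)]
    exact hK1
  have hM₀ : 0 ≤ M := by
    refine le_trans ?_ hM
    have := Real.log_nonneg hE1
    positivity
  obtain ⟨A, hA⟩ := exists_explore_exp_regret_le (J := J) (fun j => j.2) T η lam δ M hη hlam.le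
    ((pow_nonneg hq B).trans hBδ) hδ hM hM₀ T le_rfl B (fun _ => 1) (fun _ => 1)
    (fun _ => zero_le_one) (fun _ => zero_le_one) (fun _ => by simpa using hBδ)
    (fun j => List.ofFn j.1.1) (fun j => by simp)
    (fun j ρ hρ => by
      obtain ⟨t, rfl⟩ := (List.mem_ofFn' _ _).mp hρ
      exact j.1.2 t)
  refine ⟨A, fun r hr hS i => ?_⟩
  subst hr
  let j : J := (⟨r.get, fun t => hS _ (List.get_mem r t)⟩, i)
  have h1 := (Finset.single_le_sum (f := fun j : J => (1 : ℝ) * Real.exp (lam * (1 *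
      (contextMistakes A (List.ofFn j.1.1) - expertMistakes j.2 (List.ofFn j.1.1) - B))))
      (fun j _ => by positivity) (Finset.mem_univ j)).trans hA
  have hj : List.ofFn j.1.1 = r := List.ofFn_get r
  simp only [hj, one_mul, Finset.sum_const, Finset.card_univ, nsmul_eq_mul] at h1
  have hJ0 : (0 : ℝ) < Fintype.card J := by exact_mod_cast Fintype.card_pos_iff.mpr ⟨j⟩
  have hJ : Real.log (Fintype.card J) ≤ lam := by
    have h2 : Fintype.card J ≤
        (Fintype.card Y ^ Fintype.card E * 2 ^ Fintype.card Y) ^ r.length * Fintype.card E := by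
      rw [Fintype.card_prod]
      refine Nat.mul_le_mul_right _ ((Fintype.card_subtype_le _).trans ?_)
      simp
    have h3 : (Fintype.card J : ℝ) ≤
        ((Fintype.card Y : ℝ) ^ Fintype.card E * 2 ^ Fintype.card Y) ^ r.length *
          Fintype.card E := by exact_mod_cast h2
    refine (Real.log_le_log hJ0 h3).trans (le_trans (le_of_eq ?_) hcard)
    rw [Real.log_mul (by positivity) (by positivity), Real.log_pow,
      Real.log_mul (by positivity) (by positivity), Real.log_pow, Real.log_pow]
  have h4 : lam * (contextMistakes A r - expertMistakes i r - B) ≤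
      lam + (lam * M + lam ^ 2 * r.length ^ 2 * δ) := by
    have h5 := Real.log_le_log (Real.exp_pos _) h1
    rw [Real.log_exp, Real.log_mul hJ0.ne' (Real.exp_ne_zero _), Real.log_exp] at h5
    exact h5.trans (by linarith)
  have h6 : lam * (contextMistakes A r - expertMistakes i r - B) ≤
      lam * (1 + M + lam * r.length ^ 2 * δ) := by
    refine h4.trans (le_of_eq ?_)
    ring
  linarith [le_of_mul_le_mul_left h6 hlam]

end Explore

/-- The hypotheses of `V` consistent with label `y` and with `a` being a mistake at `x`. -/
def mistakeRestrict {X Y : Type} (V : Set (X → Set Y)) (x : X) (a y : Y) : Set (X → Set Y) :=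
  {h ∈ V | y ∈ h x ∧ a ∉ h x}

/-- No tree of depth `n` is shattered by `V` in the mistake-known sense. -/
def NoShatter {X Y : Type} (V : Set (X → Set Y)) (n : ℕ) : Prop :=
  ∀ T : MTree X Y n, ¬ ShattersK V T

section SOA

variable {X Y : Type}

theorem NoShatter.not_mem_of_zero {V : Set (X → Set Y)} (hV : NoShatter V 0) (h : X → Set Y) :
    h ∉ V := fun hh =>
  hV ⟨fun t => t.elim0, fun t => t.elim0⟩ fun _ => ⟨h, hh, fun t => t.elim0, fun t => t.elim0⟩

theorem NoShatter.exists_prediction {V : Set (X → Set Y)} {n : ℕ} (hV : NoShatter V (n + 1))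
    (x : X) : ∃ a, ∀ y, NoShatter (mistakeRestrict V x a y) n := by
  by_contra! hc
  have hc' : ∀ a, ∃ y, ∃ T : MTree X Y n, ShattersK (mistakeRestrict V x a y) T := by
    intro a
    obtain ⟨y, hy⟩ := hc a
    unfold NoShatter at hy
    push Not at hy
    exact ⟨y, hy⟩
  choose lab tree htree using hc'
  let inst' : ∀ t : Fin (n + 1), (Fin t.1 → Y) → X :=
    Fin.cases (fun _ => x) fun t σ => (tree (σ ⟨0, by simp⟩)).inst t fun i => σ ⟨i.1 + 1, by simp⟩
  let lab' : ∀ t : Fin (n + 1), (Fin t.1 → Y) → Y → Y :=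
    Fin.cases (fun _ a => lab a) fun t σ a =>
      (tree (σ ⟨0, by simp⟩)).lab t (fun i => σ ⟨i.1 + 1, by simp⟩) a
  refine hV ⟨inst', lab'⟩ fun σ => ?_
  obtain ⟨h, ⟨hhV, hy, ha⟩, hcon, hmis⟩ := htree (σ 0) (fun t => σ t.succ)
  refine ⟨h, hhV, fun t => ?_, fun t => ?_⟩
  · induction t using Fin.cases with
    | zero => exact hy
    | succ t => exact hcon t
  · induction t using Fin.cases with
    | zero => exact ha
    | succ t => exact hmis t

theorem noShatter_of_LDK {H : Set (X → Set Y)} {d n : ℕ} (hd : LDK H = (d : ℕ∞)) (hn : d < n) :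
    NoShatter H n := by
  intro T hT
  have h : (n : ℕ∞) ≤ LDK H := le_iSup₂_of_le n ⟨T, hT⟩ le_rfl
  rw [hd] at h
  exact absurd (Nat.cast_le.mp h) (by omega)

open scoped Classical in
/-- The prediction of the mistake-known standard optimal algorithm with version space `V` and
remaining mistake budget `k`. -/
noncomputable def soaPredict [Nonempty Y] (V : Set (X → Set Y)) (k : ℕ) (x : X) : Y :=
  if h : ∃ a, ∀ y, NoShatter (mistakeRestrict V x a y) k then h.choose
  else Classical.arbitrary Y

theorem NoShatter.restrict_soaPredict [Nonempty Y] {V : Set (X → Set Y)} {k : ℕ}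
    (hV : NoShatter V (k + 1)) (x : X) (y : Y) :
    NoShatter (mistakeRestrict V x (soaPredict V k x) y) k := by
  have h := hV.exists_prediction x
  rw [soaPredict, dif_pos h]
  exact h.choose_spec y

/-- The state of an expert: version space, mistake budget, and the set of future rounds on which it
updates. -/
structure ExpertState (X Y : Type) where
  space : Set (X → Set Y)
  budget : ℕ
  updates : ℕ → Prop

/-- The prediction of an expert. -/
noncomputable def ExpertState.predict [Nonempty Y] (s : ExpertState X Y) (x : X) : Y :=
  soaPredict s.space s.budget x

open scoped Classical in
/-- The state of an expert after a round. -/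
noncomputable def ExpertState.next [Nonempty Y] (s : ExpertState X Y) (x : X) (y : Y) :
    ExpertState X Y :=
  if s.updates 0 then
    ⟨mistakeRestrict s.space x (s.predict x) y, s.budget - 1, fun n => s.updates (n + 1)⟩
  else ⟨s.space, s.budget, fun n => s.updates (n + 1)⟩

/-- Number of mistakes of an expert. -/
noncomputable def ExpertState.mistakes [Nonempty Y] :
    ExpertState X Y → List (X × Y × Set Y) → ℝ
  | _, [] => 0
  | s, (x, y, S) :: r => setLoss S (s.predict x) + (s.next x y).mistakes r

open scoped Classical in
/-- Number of rounds on which the hypothesis differs from the correct set. -/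
noncomputable def disagreements (h : X → Set Y) (r : List (X × Y × Set Y)) : ℝ :=
  (r.map fun ρ => if h ρ.1 ≠ ρ.2.2 then (1 : ℝ) else 0).sum

/-- Every hypothesis is followed, up to the mistake budget, by an expert with few updates. -/
theorem exists_updates_mistakes_le [Nonempty Y] (r : List (X × Y × Set Y))
    (hr : ∀ ρ ∈ r, ρ.2.1 ∈ ρ.2.2) (h : X → Set Y) (V : Set (X → Set Y)) (hV : h ∈ V) (k : ℕ)
    (hk : NoShatter V (k + 1)) :
    ∃ l : List ℕ, l.length ≤ k ∧ (∀ n ∈ l, n < r.length) ∧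
      ExpertState.mistakes ⟨V, k, (· ∈ l)⟩ r ≤ disagreements h r + k := by
  classical
  induction r generalizing V k with
  | nil => exact ⟨[], by simp, by simp, by simp [ExpertState.mistakes, disagreements]⟩
  | cons ρ r ih =>
    obtain ⟨x, y, S⟩ := ρ
    have hyS : y ∈ S := hr (x, y, S) (by simp)
    have hr' : ∀ ρ ∈ r, ρ.2.1 ∈ ρ.2.2 := fun ρ hρ => hr ρ (by simp [hρ])
    have hdis : disagreements h ((x, y, S) :: r) =
        (if h x ≠ S then 1 else 0) + disagreements h r := by
      simp [disagreements]
    set a := soaPredict V k x with ha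
    by_cases hup : h x = S ∧ a ∉ S
    · obtain ⟨hhS, haS⟩ := hup
      have hmem : h ∈ mistakeRestrict V x a y := ⟨hV, hhS ▸ hyS, hhS ▸ haS⟩
      have hk' := hk.restrict_soaPredict x y
      rw [← ha] at hk'
      rcases k with _ | k
      · exact absurd hmem (hk'.not_mem_of_zero h)
      obtain ⟨l, hl, hlt, hle⟩ := ih hr' _ hmem k hk'
      refine ⟨0 :: l.map Nat.succ, by simpa using hl, ?_, ?_⟩
      · intro n hn
        simp only [List.mem_cons, List.mem_map] at hn
        rcases hn with rfl | ⟨m, hm, rfl⟩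
        · simp
        · simpa using hlt m hm
      · have hnext : ExpertState.next ⟨V, k + 1, (· ∈ 0 :: l.map Nat.succ)⟩ x y =
            ⟨mistakeRestrict V x a y, k, (· ∈ l)⟩ := by
          simp [ExpertState.next, ExpertState.predict, ← ha]
        rw [ExpertState.mistakes, hnext, hdis]
        have := setLoss_le_one S (ExpertState.predict ⟨V, k + 1, (· ∈ 0 :: l.map Nat.succ)⟩ x)
        rw [if_neg (not_not.mpr hhS)]
        push_cast
        linarith
    · obtain ⟨l, hl, hlt, hle⟩ := ih hr' V hV k hk
      refine ⟨l.map Nat.succ, by simpa using hl, ?_, ?_⟩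
      · intro n hn
        simp only [List.mem_map] at hn
        obtain ⟨m, hm, rfl⟩ := hn
        simpa using hlt m hm
      · have hnext : ExpertState.next ⟨V, k, (· ∈ l.map Nat.succ)⟩ x y = ⟨V, k, (· ∈ l)⟩ := by
          simp [ExpertState.next]
        rw [ExpertState.mistakes, hnext, hdis]
        have hloss : setLoss S (ExpertState.predict ⟨V, k, (· ∈ l.map Nat.succ)⟩ x) ≤
            (if h x ≠ S then 1 else 0) := by
          change setLoss S a ≤ _
          by_cases hhS : h x = S
          · have : a ∈ S := by tauto
            simp [setLoss, this, hhS]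
          · simpa [hhS] using setLoss_le_one S a
        linarith

end SOA

section Lift

variable {X Y E : Type} [Nonempty Y]

/-- The rounds of the context game induced by the experts. -/
noncomputable def contextRounds : (E → ExpertState X Y) → List (X × Y × Set Y) →
    List ((E → Y) × Set Y)
  | _, [] => []
  | s, (x, y, S) :: r =>
    (fun i => (s i).predict x, S) :: contextRounds (fun i => (s i).next x y) r

/-- The learner that feeds the expert predictions to a learner of the context game. -/
noncomputable def liftLearner : (E → ExpertState X Y) →
    (List ((E → Y) × Bool) → (E → Y) → PMF Y) → List (X × Y × Bool) → X → PMF Y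
  | s, P, [], x => P [] fun i => (s i).predict x
  | s, P, (x', y', b) :: h, x => liftLearner (fun i => (s i).next x' y')
      (fun h' => P ((fun i => (s i).predict x', b) :: h')) h x

theorem expectedMistakes_liftLearner [Fintype Y] (s : E → ExpertState X Y)
    (P : List ((E → Y) × Bool) → (E → Y) → PMF Y) (r : List (X × Y × Set Y)) :
    expectedMistakes (liftLearner s P) r = contextMistakes P (contextRounds s r) := by
  induction r generalizing s P with
  | nil => rfl
  | cons ρ r ih =>
    obtain ⟨x, y, S⟩ := ρ
    rw [expectedMistakes, contextRounds, contextMistakes]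
    refine Finset.sum_congr rfl fun a _ => ?_
    rw [← ih]
    rfl

theorem length_contextRounds (s : E → ExpertState X Y) (r : List (X × Y × Set Y)) :
    (contextRounds s r).length = r.length := by
  induction r generalizing s with
  | nil => rfl
  | cons ρ r ih => simp [contextRounds, ih]

theorem contextRounds_nonempty (s : E → ExpertState X Y) (r : List (X × Y × Set Y))
    (hr : ∀ ρ ∈ r, ρ.2.1 ∈ ρ.2.2) : ∀ ρ ∈ contextRounds s r, ρ.2.Nonempty := by
  induction r generalizing s with
  | nil => simp [contextRounds]
  | cons ρ r ih =>
    intro τ hτ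
    rcases List.mem_cons.mp hτ with rfl | hτ
    · exact ⟨_, hr ρ (by simp)⟩
    · exact ih _ (fun ρ' h' => hr ρ' (by simp [h'])) τ hτ

theorem expertMistakes_contextRounds (s : E → ExpertState X Y) (r : List (X × Y × Set Y)) (i : E) :
    expertMistakes i (contextRounds s r) = (s i).mistakes r := by
  induction r generalizing s with
  | nil => simp [contextRounds, expertMistakes, ExpertState.mistakes]
  | cons ρ r ih =>
    obtain ⟨x, y, S⟩ := ρ
    rw [contextRounds, expertMistakes_cons, ih, ExpertState.mistakes]

end Lift

/-- Every list of at most `d` rounds below `T` is enumerated by some `Fin d → Option (Fin T)`. -/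
theorem exists_option_enumeration {d T : ℕ} (l : List ℕ) (hl : l.length ≤ d)
    (hlt : ∀ n ∈ l, n < T) :
    ∃ g : Fin d → Option (Fin T), ∀ n, n ∈ l ↔ ∃ i t, g i = some t ∧ t.1 = n := by
  refine ⟨fun i => if h : i.1 < l.length then some ⟨l[i.1], hlt _ (List.getElem_mem h)⟩ else none,
    fun n => ⟨fun hn => ?_, ?_⟩⟩
  · obtain ⟨i, hi, rfl⟩ := List.getElem_of_mem hn
    exact ⟨⟨i, by omega⟩, ⟨l[i], hlt _ hn⟩, by simp [hi], rfl⟩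
  · rintro ⟨i, t, hi, rfl⟩
    beta_reduce at hi
    split_ifs at hi with h
    have := Option.some.inj hi
    rw [← this]
    exact List.getElem_mem h

/-- Regret against every hypothesis, with all parameters explicit. -/
theorem exists_learner_of_parameters {X Y : Type} [Fintype Y] [Nonempty Y] (H : Set (X → Set Y))
    (d T : ℕ) (hd : LDK H = (d : ℕ∞)) (B : ℕ) (η lam δ M : ℝ) (hη : 0 < η) (hlam : 0 < lam)
    (hδ : lam * δ * T ≤ 1) (hBδ : (1 - 1 / (Fintype.card Y : ℝ)) ^ B ≤ δ)
    (hM : 1 / η * (d * Real.log (T + 1)) + η * Fintype.card Y / 2 * T ≤ M)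
    (hcard : T * ((T + 1) ^ d * Real.log (Fintype.card Y) + Fintype.card Y * Real.log 2) +
      d * Real.log (T + 1) ≤ lam) :
    ∃ A : List (X × Y × Bool) → X → PMF Y, ∀ r : List (X × Y × Set Y), r.length = T →
      (∀ ρ ∈ r, ρ.2.1 ∈ ρ.2.2) → ∀ h ∈ H,
        expectedMistakes A r ≤ disagreements h r + d + B + M + 1 + lam * T ^ 2 * δ := by
  have hE : (Fintype.card (Fin d → Option (Fin T)) : ℝ) = ((T : ℝ) + 1) ^ d := by simp
  have hlogE : Real.log (Fintype.card (Fin d → Option (Fin T))) = d * Real.log (T + 1) := by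
    rw [hE, Real.log_pow]
  obtain ⟨P, hP⟩ := exists_context_learner (E := Fin d → Option (Fin T)) (Y := Y) T B η lam δ M
    hη hlam hδ hBδ (by rwa [hlogE]) (by rwa [hlogE, hE])
  let s : (Fin d → Option (Fin T)) → ExpertState X Y := fun g =>
    ⟨H, d, fun n => ∃ i t, g i = some t ∧ t.1 = n⟩
  refine ⟨liftLearner s P, fun r hr hyS h hh => ?_⟩
  obtain ⟨l, hl, hlt, hle⟩ := exists_updates_mistakes_le r hyS h H hh d
    (noShatter_of_LDK hd (Nat.lt_succ_self d))
  rw [hr] at hlt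
  obtain ⟨g, hg⟩ := exists_option_enumeration l hl hlt
  have hs : s g = ⟨H, d, (· ∈ l)⟩ := by
    simp only [s, hg]
  have h1 := hP (contextRounds s r) (by rw [length_contextRounds, hr])
    (contextRounds_nonempty s r hyS) g
  rw [expertMistakes_contextRounds, hs] at h1
  rw [expectedMistakes_liftLearner]
  linarith

theorem expectedMistakes_le_length {X Y : Type} [Fintype Y]
    (A : List (X × Y × Bool) → X → PMF Y) (r : List (X × Y × Set Y)) :
    expectedMistakes A r ≤ r.length := by
  induction r generalizing A with
  | nil => simp [expectedMistakes]
  | cons ρ r ih =>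
    obtain ⟨x, y, S⟩ := ρ
    calc expectedMistakes A ((x, y, S) :: r)
        ≤ ∑ a, (A [] x a).toReal * ((r.length : ℝ) + 1) := by
          refine Finset.sum_le_sum fun a _ =>
            mul_le_mul_of_nonneg_left ?_ ENNReal.toReal_nonneg
          linarith [setLoss_le_one S a, ih fun h => A ((x, y, mistakeBit S a) :: h)]
      _ = ((x, y, S) :: r).length := by
          rw [← Finset.sum_mul, PMF.sum_toReal_eq_one]
          simp

theorem expectedMistakes_pure {X Y : Type} [Fintype Y] (f : X → Y) (r : List (X × Y × Set Y)) :
    expectedMistakes (fun _ x => PMF.pure (f x)) r =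
      (r.map fun ρ => setLoss ρ.2.2 (f ρ.1)).sum := by
  classical
  induction r with
  | nil => simp [expectedMistakes]
  | cons ρ r ih =>
    obtain ⟨x, y, S⟩ := ρ
    rw [expectedMistakes, ih, Finset.sum_eq_single (f x)]
    · simp
    · intro a _ ha
      simp [PMF.pure_apply, ha]
    · simp

theorem disagreements_nonneg {X Y : Type} (h : X → Set Y) (r : List (X × Y × Set Y)) :
    0 ≤ disagreements h r := by
  refine List.sum_nonneg (List.forall_mem_map.mpr fun ρ _ => ?_)
  split_ifs <;> norm_num

theorem exists_learner_of_noShatter_one {X Y : Type} [Fintype Y] (H : Set (X → Set Y))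
    (hH : NoShatter H 1) :
    ∃ A : List (X × Y × Bool) → X → PMF Y, ∀ r : List (X × Y × Set Y),
      (∀ ρ ∈ r, ρ.2.1 ∈ ρ.2.2) → ∀ h ∈ H, expectedMistakes A r ≤ disagreements h r := by
  choose f hf using fun x => hH.exists_prediction x
  refine ⟨fun _ x => PMF.pure (f x), fun r hr h hh => ?_⟩
  rw [expectedMistakes_pure, disagreements]
  refine List.sum_le_sum fun ρ hρ => ?_
  split_ifs with hne
  · exact setLoss_le_one _ _
  · have hS : h ρ.1 = ρ.2.2 := not_not.mp hne
    have hmem : f ρ.1 ∈ ρ.2.2 := by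
      by_contra hn
      exact (hf ρ.1 ρ.2.1).not_mem_of_zero h ⟨hh, hS ▸ hr ρ hρ, hS ▸ hn⟩
    simp [setLoss, hmem]

theorem one_sub_inv_pow_le {K : ℝ} (hK : 1 ≤ K) {B : ℕ} {T : ℝ} (hT : 0 < T) {m : ℕ}
    (hB : m * K * Real.log T ≤ B) : (1 - 1 / K) ^ B ≤ (T ^ m)⁻¹ := by
  have hK0 : 0 < K := by linarith
  have h1 : 1 - 1 / K ≤ Real.exp (-(1 / K)) := by
    linarith [Real.add_one_le_exp (-(1 / K))]
  have h0 : 0 ≤ 1 - 1 / K := by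
    rw [sub_nonneg, div_le_one hK0]
    exact hK
  calc (1 - 1 / K) ^ B ≤ Real.exp (-(1 / K)) ^ B := pow_le_pow_left₀ h0 h1 B
    _ = Real.exp (-(B / K)) := by rw [← Real.exp_nat_mul]; ring_nf
    _ ≤ Real.exp (-(m * Real.log T)) := by
        refine Real.exp_le_exp.mpr (neg_le_neg ?_)
        rw [le_div_iff₀ hK0]
        linarith
    _ = (T ^ m)⁻¹ := by
        rw [Real.exp_neg, ← Real.log_pow, Real.exp_log (by positivity)]

set_option maxHeartbeats 600000 in
theorem exists_learner_of_large_horizon {X Y : Type} [Fintype Y] [Nonempty Y]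
    (H : Set (X → Set Y)) (d T : ℕ) (hd : LDK H = (d : ℕ∞)) (hd1 : 1 ≤ d)
    (hT : (d : ℝ) + 4 * Real.sqrt (Fintype.card Y * T * Real.log T * d) < T) :
    ∃ A : List (X × Y × Bool) → X → PMF Y, ∀ r : List (X × Y × Set Y), r.length = T →
      (∀ ρ ∈ r, ρ.2.1 ∈ ρ.2.2) → ∀ h ∈ H, expectedMistakes A r ≤
        disagreements h r + (d + 4 * Real.sqrt (Fintype.card Y * T * Real.log T * d)) := by
  set K : ℝ := (Fintype.card Y : ℝ) with hK
  set L : ℝ := Real.log T with hL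
  set R : ℝ := Real.sqrt (K * T * L * d) with hR
  have hK1 : (1 : ℝ) ≤ K := by rw [hK]; exact_mod_cast Fintype.card_pos
  have hd1' : (1 : ℝ) ≤ d := by exact_mod_cast hd1
  have hR0 : 0 ≤ R := Real.sqrt_nonneg _
  have hT2 : (2 : ℝ) ≤ T := by
    have h1 : (1 : ℝ) < T := by linarith
    have h2 : 1 < T := by exact_mod_cast h1
    exact_mod_cast h2
  have hL2 : Real.log 2 ≤ L := Real.log_le_log (by norm_num) hT2
  have hlog2 := Real.log_two_gt_d9
  have hL0 : 0 < L := by linarith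
  have hsq : R ^ 2 = K * L * d * T := by
    rw [hR, Real.sq_sqrt (by positivity)]; ring
  set Q : ℝ := K * L * d with hQ
  have hQL : L ≤ Q := by
    have : 1 ≤ K * d := by nlinarith
    rw [hQ]; nlinarith
  have hT16 : 16 * Q < T := by
    have : (4 * R) ^ 2 < (T : ℝ) ^ 2 := pow_lt_pow_left₀ (by linarith) (by linarith) two_ne_zero
    nlinarith
  have hT11 : (11 : ℝ) ≤ T := by linarith
  have hL1 : 1 ≤ L := by
    rw [hL, Real.le_log_iff_exp_le (by linarith)]
    linarith [Real.exp_one_lt_d9]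
  have hKL : K * d ≤ Q := by
    have : 0 < K * d := by positivity
    rw [hQ]; nlinarith
  have hQ1 : 1 ≤ Q := by linarith
  have h3K : 3 * K ≤ T := by nlinarith
  have hT16' : (16 : ℝ) ≤ T := by linarith
  have hL2' : 2 ≤ L := by
    have h1 : Real.log 16 ≤ L := Real.log_le_log (by norm_num) hT16'
    have h2 : Real.log 16 = 4 * Real.log 2 := by
      rw [show (16 : ℝ) = 2 ^ 4 by norm_num, Real.log_pow]; norm_num
    linarith
  have hR4 : 4 * Q ≤ R := by
    refine le_of_sq_le_sq ?_ hR0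
    nlinarith
  have hR6 : 6 ≤ R := by linarith
  have hlogT : Real.log (T + 1) ≤ 2 * L := by
    rw [hL, ← Real.log_rpow (by linarith)]
    refine Real.log_le_log (by linarith) ?_
    rw [Real.rpow_two]
    nlinarith
  have hN1 : (1 : ℝ) ≤ ((T : ℝ) + 1) ^ d := one_le_pow₀ (by linarith)
  set N : ℝ := ((T : ℝ) + 1) ^ d with hN
  have hNlog : d * Real.log (T + 1) ≤ N := by
    rw [← Real.log_pow, ← hN]
    linarith [Real.log_le_sub_one_of_pos (show 0 < N by linarith)]
  have hlam0 : 0 < 3 * T * N * K := by positivity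
  set B : ℕ := ⌈6 * Q⌉₊ with hB
  have hB1 : 6 * Q ≤ B := Nat.le_ceil _
  have hB2 : (B : ℝ) ≤ 6 * Q + 1 := (Nat.ceil_lt_add_one (by linarith)).le
  have hδ : (1 - 1 / K) ^ B ≤ ((T : ℝ) ^ (6 * d))⁻¹ := by
    refine one_sub_inv_pow_le hK1 (by linarith) ?_
    push_cast
    rw [← hL]
    linarith
  have hδT : 3 * T * N * K * T ^ 2 * ((T : ℝ) ^ (6 * d))⁻¹ ≤ 1 := by
    rw [mul_inv_le_iff₀ (by positivity), one_mul]
    have h1 : N ≤ (T : ℝ) ^ (2 * d) := by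
      rw [hN, pow_mul]
      exact pow_le_pow_left₀ (by linarith) (by nlinarith) d
    calc 3 * T * N * K * T ^ 2 = (3 * K) * N * T ^ 3 := by ring
      _ ≤ T * (T : ℝ) ^ (2 * d) * T ^ 3 := by gcongr
      _ = (T : ℝ) ^ (2 * d + 4) := by ring
      _ ≤ (T : ℝ) ^ (6 * d) := pow_le_pow_right₀ (by linarith) (by omega)
  obtain ⟨A, hA⟩ := exists_learner_of_parameters H d T hd B (2 * R / (K * T)) (3 * T * N * K)
    ((T : ℝ) ^ (6 * d))⁻¹ (2 * R) (by positivity) hlam0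
    (by
      refine le_trans ?_ hδT
      rw [mul_right_comm (3 * T * N * K)]
      gcongr
      exact le_self_pow₀ (by linarith) two_ne_zero)
    hδ
    (by
      have h1 : 1 / (2 * R / (K * T)) * (d * Real.log (T + 1)) ≤ R := by
        calc 1 / (2 * R / (K * T)) * (d * Real.log (T + 1))
            ≤ 1 / (2 * R / (K * T)) * (d * (2 * L)) := by gcongr
          _ = R ^ 2 / R := by rw [hsq, hQ]; field_simp
          _ = R := by field_simp
      have h2 : 2 * R / (K * T) * K / 2 * T = R := by field_simp
      rw [← hK, h2]
      linarith)
    (by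
      rw [← hK, ← hN]
      have h1 : Real.log K ≤ K := by linarith [Real.log_le_sub_one_of_pos (show 0 < K by linarith)]
      have h2 : Real.log 2 ≤ 1 := by linarith [Real.log_two_lt_d9]
      have h3 : T * (N * Real.log K + K * Real.log 2) ≤ T * (N * K + K * N) := by
        gcongr
        linarith
      have h4 : N ≤ T * N * K := by
        have : 1 ≤ T * K := by nlinarith
        nlinarith
      linarith)
  refine ⟨A, fun r hr hy h hh => ?_⟩
  have h1 := hA r hr hy h hh
  linarith

theorem exists_learner_regret_le {X Y : Type} [Fintype Y] (H : Set (X → Set Y))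
    (d T : ℕ) (hd : LDK H = (d : ℕ∞)) :
    ∃ A : List (X × Y × Bool) → X → PMF Y, ∀ r : List (X × Y × Set Y), r.length = T →
      (∀ ρ ∈ r, ρ.2.1 ∈ ρ.2.2) → ∀ h ∈ H, expectedMistakes A r ≤
        disagreements h r + (d + 4 * Real.sqrt (Fintype.card Y * T * Real.log T * d)) := by
  rcases d.eq_zero_or_pos with rfl | hd1
  · obtain ⟨A, hA⟩ := exists_learner_of_noShatter_one H (noShatter_of_LDK hd one_pos)
    exact ⟨A, fun r _ hr h hh => by simpa using hA r hr h hh⟩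
  rcases isEmpty_or_nonempty X with hX | ⟨⟨x⟩⟩
  · refine ⟨fun _ => isEmptyElim, fun r _ _ h _ => ?_⟩
    have : r = [] := List.eq_nil_iff_forall_not_mem.mpr fun ρ => isEmptyElim ρ.1
    subst this
    have := disagreements_nonneg h ([] : List (X × Y × Set Y))
    simp only [expectedMistakes]
    positivity
  · obtain ⟨y, -⟩ := (noShatter_of_LDK hd d.lt_succ_self).exists_prediction x
    have : Nonempty Y := ⟨y⟩
    rcases lt_or_ge ((d : ℝ) + 4 * Real.sqrt (Fintype.card Y * T * Real.log T * d)) T with hT | hT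
    · exact exists_learner_of_large_horizon H d T hd hd1 hT
    · refine ⟨fun _ _ => PMF.pure y, fun r hr _ h _ => ?_⟩
      have h1 := expectedMistakes_le_length (fun _ _ => PMF.pure y) r
      rw [hr] at h1
      linarith [disagreements_nonneg h r]

open scoped Classical in
/-- Agnostic mistake-known online learning: there is a randomized learner whose regret is
O(√(|Y|·T·LDK(H)·log T)). The expected loss is computed over the distribution on full
prediction trajectories π induced by the learner (whose feedback at each round includes
the label `y_t` and the mistake bit of its own prediction). -/
theorem stmt17 {X Y : Type} [Fintype Y] (H : Set (X → Set Y)) (hne : H.Nonempty)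
    (d T : ℕ) (hd : LDK H = (d : ℕ∞)) (hT : d ≤ T) :
    ∃ A : List (X × Y × Bool) → X → PMF Y,
      ∀ (x : Fin T → X) (y : Fin T → Y) (S : Fin T → Set Y), (∀ t, y t ∈ S t) →
        (∑ π : Fin T → Y,
            (∏ t : Fin T,
              ((A (List.ofFn fun i : Fin t.1 =>
                    (x ⟨i.1, i.isLt.trans t.isLt⟩, y ⟨i.1, i.isLt.trans t.isLt⟩,
                      if π ⟨i.1, i.isLt.trans t.isLt⟩ ∈ S ⟨i.1, i.isLt.trans t.isLt⟩ then false
                      else true)) (x t)) (π t)).toReal) *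
            (∑ t : Fin T, if π t ∉ S t then (1 : ℝ) else 0))
          - ⨅ h : H, ∑ t : Fin T, (if (h : X → Set Y) (x t) ≠ S t then (1 : ℝ) else 0)
        ≤ (d : ℝ) + 4 * Real.sqrt ((Fintype.card Y) * T * Real.log T * d) := by
  have := hne.to_subtype
  obtain ⟨A, hA⟩ := exists_learner_regret_le H d T hd
  refine ⟨A, fun x y S hyS => ?_⟩
  have hloss := sum_trajectoryProb_mul_loss A x y S
  unfold trajectoryProb mistakeBit setLoss at hloss
  rw [hloss, sub_le_iff_le_add', ← sub_le_iff_le_add]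
  refine le_ciInf fun h => ?_
  have h1 := hA (List.ofFn fun t => (x t, y t, S t)) (by simp)
    (fun ρ hρ => by
      obtain ⟨t, rfl⟩ := (List.mem_ofFn' _ _).mp hρ
      exact hyS t) h h.2
  rw [disagreements, List.map_ofFn, List.sum_ofFn] at h1
  simp only [Function.comp_apply] at h1
  linarith
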